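/- Exact ReLU gating of the matching score: let n ≥ 1, r ≥ 1, and M be natural numbers with M ≥ 2 and n ≤ M, let a, b : Fin r → Fin n (values viewed as integers in {0, …, n−1}), and let c > 0 be a real number. Then max(0, c · ∑_{l} cos(2π · (a_l − b_l) / M) − c · (r − 1/M²)) equals c/M² if a = b and equals 0 if a ≠ b. Hence, after subtracting the threshold c(r − 1/M²), a ReLU applied to the cosine score is an exact (rescaled) indicator of index agreement. -/

import Mathlib

open Finset Real

lemma cos_two_pi_mul_div_le_of_two_mul_le {M k : ℝ} (hk : 1 ≤ k) (hkM : 2 * k ≤ M) :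
    Real.cos (2 * Real.pi * k / M) ≤ 1 - 1 / M ^ 2 := by
  have hM : 0 < M := by linarith
  have hx : |2 * Real.pi * k / M| ≤ Real.pi := by
    rw [abs_of_nonneg (by positivity), div_le_iff₀ hM]
    nlinarith [Real.pi_pos]
  refine (Real.cos_le_one_sub_mul_cos_sq hx).trans ?_
  have h : 2 / Real.pi ^ 2 * (2 * Real.pi * k / M) ^ 2 = 8 * k ^ 2 / M ^ 2 := by
    field_simp
    ring
  rw [h]
  gcongr
  nlinarith

lemma cos_two_pi_mul_div_le {M k : ℝ} (hk : 1 ≤ |k|) (hkM : |k| ≤ M - 1) :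
    Real.cos (2 * Real.pi * k / M) ≤ 1 - 1 / M ^ 2 := by
  have hM : 0 < M := by linarith
  have habs : Real.cos (2 * Real.pi * k / M) = Real.cos (2 * Real.pi * |k| / M) := by
    rw [← Real.cos_abs, abs_div, abs_mul, abs_of_pos hM, abs_of_pos Real.two_pi_pos]
  rw [habs]
  rcases le_total (2 * |k|) M with h | h
  · exact cos_two_pi_mul_div_le_of_two_mul_le hk h
  · have hrefl : 2 * Real.pi * |k| / M = 2 * Real.pi - 2 * Real.pi * (M - |k|) / M := by
      field_simp
      ring
    rw [hrefl, Real.cos_two_pi_sub]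
    exact cos_two_pi_mul_div_le_of_two_mul_le (by linarith) (by linarith)

lemma cos_two_pi_mul_fin_sub_div_le {n M : ℕ} (hnM : n ≤ M) {i j : Fin n} (hij : i ≠ j) :
    Real.cos (2 * Real.pi * (((i : ℤ) - (j : ℤ)) : ℝ) / (M : ℝ)) ≤ 1 - 1 / (M : ℝ) ^ 2 := by
  have hne : (i : ℕ) ≠ j := Fin.val_ne_of_ne hij
  have h1 : (1 : ℤ) ≤ |(i : ℤ) - (j : ℤ)| := Int.one_le_abs (by omega)
  have h2 : |(i : ℤ) - (j : ℤ)| ≤ (M : ℤ) - 1 := abs_le.2 ⟨by omega, by omega⟩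
  exact cos_two_pi_mul_div_le (by exact_mod_cast h1) (by exact_mod_cast h2)

/-- Exact ReLU gating of the matching score: after subtracting the threshold
`c (r - 1/M²)`, a ReLU applied to the scaled cosine matching score is an exact
rescaled indicator of index agreement: it equals `c/M²` when `a = b` and `0`
when `a ≠ b`. -/
theorem relu_gating_matching_score (n r M : ℕ) (hn : 1 ≤ n) (hr : 1 ≤ r)
    (hM : 2 ≤ M) (hnM : n ≤ M) (a b : Fin r → Fin n) (c : ℝ) (hc : 0 < c) :
    (a = b →
      max 0 (c * (∑ l, Real.cos (2 * Real.pi * (((a l : ℤ) - (b l : ℤ)) : ℝ) / (M : ℝ)))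
        - c * ((r : ℝ) - 1 / (M : ℝ) ^ 2)) = c / (M : ℝ) ^ 2) ∧
    (a ≠ b →
      max 0 (c * (∑ l, Real.cos (2 * Real.pi * (((a l : ℤ) - (b l : ℤ)) : ℝ) / (M : ℝ)))
        - c * ((r : ℝ) - 1 / (M : ℝ) ^ 2)) = 0) := by
  refine ⟨?_, fun hab => ?_⟩
  · rintro rfl
    have h : c * (r : ℝ) - c * ((r : ℝ) - 1 / (M : ℝ) ^ 2) = c / (M : ℝ) ^ 2 := by ring
    simp only [sub_self, mul_zero, zero_div, Real.cos_zero, sum_const, card_univ,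
      Fintype.card_fin, nsmul_eq_mul, mul_one, h]
    exact max_eq_right (by positivity)
  · obtain ⟨l₀, hl₀⟩ := Function.ne_iff.1 hab
    rw [← mul_sub]
    refine max_eq_left (mul_nonpos_of_nonneg_of_nonpos hc.le (sub_nonpos.2 ?_))
    rw [← add_sum_erase _ _ (mem_univ l₀)]
    have hrest := sum_le_card_nsmul (univ.erase l₀)
      (fun l => Real.cos (2 * Real.pi * (((a l : ℤ) - (b l : ℤ)) : ℝ) / (M : ℝ))) 1
      (fun l _ => Real.cos_le_one _)
    rw [card_erase_of_mem (mem_univ l₀), card_univ, Fintype.card_fin, nsmul_eq_mul, mul_one,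
      Nat.cast_sub hr, Nat.cast_one] at hrest
    linarith [cos_two_pi_mul_fin_sub_div_le hnM hl₀]
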